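/- Let 0 < s < ρ be real numbers. Then the infimum, over all smooth functions w : EuclideanSpace ℝ (Fin 3) → ℝ satisfying w(y) = 0 for every y with ‖y‖ = s and w(y) ≥ 1 for every y with ‖y‖ ≥ ρ, of the integral ∫_{{y : s ≤ ‖y‖ ≤ ρ}} ‖∇w(y)‖³ dy (with respect to Lebesgue measure), equals 4π (log(ρ/s))^{−2}. -/

import Mathlib

open MeasureTheory Set Metric

namespace Cap3

abbrev E3 := EuclideanSpace ℝ (Fin 3)

/-- The closed annulus. -/
def ann (s ρ : ℝ) : Set E3 := {y | s ≤ ‖y‖ ∧ ‖y‖ ≤ ρ}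

lemma isCompact_ann (s ρ : ℝ) : IsCompact (ann s ρ) := by
  have h : ann s ρ = closedBall (0 : E3) ρ ∩ {y | s ≤ ‖y‖} := by
    ext y; simp [ann, and_comm]
  rw [h]
  exact (isCompact_closedBall _ _).inter_right (isClosed_le continuous_const continuous_norm)

lemma measurableSet_ann (s ρ : ℝ) : MeasurableSet (ann s ρ) :=
  (isCompact_ann s ρ).measurableSet

lemma sphere_mass : (volume : Measure E3).toSphere.real univ = 4 * Real.pi := by
  rw [Measure.toSphere_real_apply_univ, Measure.real, EuclideanSpace.volume_ball_fin_three]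
  have := Real.pi_pos
  simp
  rw [ENNReal.toReal_ofReal (by positivity)]
  ring

lemma polar (f : E3 → ℝ) (hf : Integrable f) :
    Integrable (fun θ : sphere (0 : E3) 1 => ∫ r in Ioi (0 : ℝ), r ^ 2 * f (r • (θ : E3)))
      (volume : Measure E3).toSphere ∧
    ∫ y, f y = ∫ θ : sphere (0 : E3) 1, (∫ r in Ioi (0 : ℝ), r ^ 2 * f (r • (θ : E3)))
      ∂(volume : Measure E3).toSphere := by
  set μ : Measure E3 := volume
  set g : sphere (0 : E3) 1 × Ioi (0 : ℝ) → ℝ := fun p => f ((p.2 : ℝ) • (p.1 : E3)) with hg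
  have hgc : ∀ x : ({0}ᶜ : Set E3), g (homeomorphUnitSphereProd E3 x) = f x := by
    intro x
    have h0 : ‖(x : E3)‖ ≠ 0 := norm_ne_zero_iff.2 x.2
    simp [hg, smul_smul, h0]
  have hmp := μ.measurePreserving_homeomorphUnitSphereProd
  have hI : Integrable g (μ.toSphere.prod (.volumeIoiPow (Module.finrank ℝ E3 - 1))) := by
    rw [← hmp.integrable_comp_emb (Homeomorph.measurableEmbedding _)]
    have : g ∘ (homeomorphUnitSphereProd E3) = f ∘ Subtype.val := by
      funext x; exact hgc x
    rw [this, ← integrableOn_iff_comap_subtypeVal (measurableSet_singleton _).compl]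
    exact hf.integrableOn
  have hin : ∀ θ : sphere (0 : E3) 1,
      ∫ r, g (θ, r) ∂(.volumeIoiPow (Module.finrank ℝ E3 - 1)) =
        ∫ r in Ioi (0 : ℝ), r ^ 2 * f (r • (θ : E3)) := by
    intro θ
    simp only [Measure.volumeIoiPow, ENNReal.ofReal]
    rw [integral_withDensity_eq_integral_smul,
      integral_subtype_comap measurableSet_Ioi
        fun a ↦ Real.toNNReal (a ^ (Module.finrank ℝ E3 - 1)) • f (a • (θ : E3)),
      setIntegral_congr_fun measurableSet_Ioi fun x hx ↦ ?_]
    · rw [NNReal.smul_def, Real.coe_toNNReal _ (pow_nonneg hx.out.le _)]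
      simp
    · exact (measurable_subtype_coe.pow_const _).real_toNNReal
  constructor
  · have := hI.integral_prod_left
    simpa only [hin] using this
  · calc ∫ y, f y ∂μ = ∫ x : ({(0)}ᶜ : Set E3), f x.1 ∂(μ.comap (↑)) := by
          rw [integral_subtype_comap (measurableSet_singleton _).compl fun x ↦ f x,
            restrict_compl_singleton]
      _ = ∫ p, g p ∂μ.toSphere.prod (.volumeIoiPow (Module.finrank ℝ E3 - 1)) := by
          rw [← hmp.integral_comp (Homeomorph.measurableEmbedding _) g]
          simp only [hgc]
      _ = _ := by
          rw [integral_prod _ hI]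
          simp only [hin]

lemma polar_ann {s ρ : ℝ} (hs : 0 < s) (hsρ : s < ρ) (f : E3 → ℝ)
    (hf : ContinuousOn f (ann s ρ)) :
    Integrable (fun θ : sphere (0 : E3) 1 => ∫ r in s..ρ, r ^ 2 * f (r • (θ : E3)))
      (volume : Measure E3).toSphere ∧
    ∫ y in ann s ρ, f y = ∫ θ : sphere (0 : E3) 1, (∫ r in s..ρ, r ^ 2 * f (r • (θ : E3)))
      ∂(volume : Measure E3).toSphere := by
  have hI : Integrable ((ann s ρ).indicator f) :=
    (integrable_indicator_iff (measurableSet_ann s ρ)).2 (hf.integrableOn_compact (isCompact_ann s ρ))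
  have h := polar _ hI
  have hin : ∀ θ : sphere (0 : E3) 1,
      ∫ r in Ioi (0 : ℝ), r ^ 2 * (ann s ρ).indicator f (r • (θ : E3)) =
       ∫ r in s..ρ, r ^ 2 * f (r • (θ : E3)) := by
    intro θ
    have hθ : ‖(θ : E3)‖ = 1 := by simpa using θ.2
    rw [intervalIntegral.integral_of_le hsρ.le, ← integral_Icc_eq_integral_Ioc]
    have : ∀ r ∈ Ioi (0 : ℝ), r ^ 2 * (ann s ρ).indicator f (r • (θ : E3)) =
        (Icc s ρ).indicator (fun r => r ^ 2 * f (r • (θ : E3))) r := by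
      intro r hr
      have hr' : 0 < r := hr
      have hn : ‖r • (θ : E3)‖ = r := by rw [norm_smul, hθ, Real.norm_of_nonneg hr'.le, mul_one]
      by_cases hm : r ∈ Icc s ρ
      · rw [indicator_of_mem hm, indicator_of_mem]
        simpa [ann, hn] using hm
      · rw [indicator_of_notMem hm, indicator_of_notMem, mul_zero]
        simpa [ann, hn] using hm
    rw [setIntegral_congr_fun measurableSet_Ioi this, setIntegral_indicator measurableSet_Icc,
      inter_eq_self_of_subset_right (show Icc s ρ ⊆ Ioi 0 from fun r hr => lt_of_lt_of_le hs hr.1)]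
  simp only [hin] at h
  rwa [integral_indicator (measurableSet_ann s ρ)] at h

lemma integral_b {s ρ : ℝ} (hs : 0 < s) (hsρ : s < ρ) :
    ∫ y in ann s ρ, (1 / (Real.log (ρ / s) * ‖y‖)) ^ 3 = 4 * Real.pi / Real.log (ρ / s) ^ 2 := by
  have hL : 0 < Real.log (ρ / s) := Real.log_pos ((one_lt_div hs).2 hsρ)
  have hc : ContinuousOn (fun y : E3 => (1 / (Real.log (ρ / s) * ‖y‖)) ^ 3) (ann s ρ) := by
    refine ContinuousOn.pow (ContinuousOn.div continuousOn_const (by fun_prop) ?_) 3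
    intro y hy
    have : 0 < ‖y‖ := lt_of_lt_of_le hs hy.1
    positivity
  rw [(polar_ann hs hsρ _ hc).2]
  have hin : ∀ θ : sphere (0 : E3) 1,
      ∫ r in s..ρ, r ^ 2 * (1 / (Real.log (ρ / s) * ‖r • (θ : E3)‖)) ^ 3 =
        1 / Real.log (ρ / s) ^ 2 := by
    intro θ
    have hθ : ‖(θ : E3)‖ = 1 := by simpa using θ.2
    have : ∀ r ∈ uIcc s ρ, r ^ 2 * (1 / (Real.log (ρ / s) * ‖r • (θ : E3)‖)) ^ 3 =
        (1 / Real.log (ρ / s) ^ 3) * r⁻¹ := by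
      intro r hr
      rw [uIcc_of_le hsρ.le] at hr
      have hr0 : 0 < r := lt_of_lt_of_le hs hr.1
      rw [norm_smul, hθ, Real.norm_of_nonneg hr0.le]
      field_simp
    rw [intervalIntegral.integral_congr this, intervalIntegral.integral_const_mul,
      integral_inv_of_pos hs (hs.trans hsρ)]
    field_simp
  simp only [hin]
  rw [integral_const, sphere_mass, smul_eq_mul]
  ring

lemma radial {s ρ : ℝ} (hs : 0 < s) (hsρ : s < ρ) {w : E3 → ℝ} (hw : ContDiff ℝ (⊤ : ℕ∞) w)
    (h0 : ∀ y, ‖y‖ = s → w y = 0) (h1 : ∀ y, ρ ≤ ‖y‖ → 1 ≤ w y) (θ : sphere (0 : E3) 1) :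
    1 ≤ ∫ r in s..ρ, ‖fderiv ℝ w (r • (θ : E3))‖ := by
  have hθ : ‖(θ : E3)‖ = 1 := by simpa using θ.2
  have hfc : Continuous (fderiv ℝ w) := hw.continuous_fderiv (by simp)
  have hd : ∀ r ∈ uIcc s ρ, HasDerivAt (fun r : ℝ => w (r • (θ : E3)))
      (fderiv ℝ w (r • (θ : E3)) θ) r := by
    intro r _
    have h2 : HasDerivAt (fun r : ℝ => r • (θ : E3)) (θ : E3) r := by
      simpa using (hasDerivAt_id r).smul_const (θ : E3)
    exact ((hw.differentiable (by simp)) _).hasFDerivAt.comp_hasDerivAt r h2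
  have hc1 : Continuous fun r : ℝ => fderiv ℝ w (r • (θ : E3)) (θ : E3) := by fun_prop
  have hft := intervalIntegral.integral_eq_sub_of_hasDerivAt hd (hc1.intervalIntegrable _ _)
  have hρ : 0 < ρ := hs.trans hsρ
  have e1 := h1 (ρ • (θ : E3)) (by rw [norm_smul, hθ, Real.norm_of_nonneg hρ.le, mul_one])
  have e0 := h0 (s • (θ : E3)) (by rw [norm_smul, hθ, Real.norm_of_nonneg hs.le, mul_one])
  calc (1 : ℝ) ≤ ∫ r in s..ρ, fderiv ℝ w (r • (θ : E3)) θ := by rw [hft]; linarith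
    _ ≤ _ := by
      refine intervalIntegral.integral_mono_on hsρ.le (hc1.intervalIntegrable _ _)
        (Continuous.intervalIntegrable (by fun_prop) _ _) fun r _ => ?_
      have := (fderiv ℝ w (r • (θ : E3))).le_opNorm (θ : E3)
      rw [hθ, mul_one] at this
      exact (le_abs_self _).trans this

lemma lower {s ρ : ℝ} (hs : 0 < s) (hsρ : s < ρ) {w : E3 → ℝ} (hw : ContDiff ℝ (⊤ : ℕ∞) w)
    (h0 : ∀ y, ‖y‖ = s → w y = 0) (h1 : ∀ y, ρ ≤ ‖y‖ → 1 ≤ w y) :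
    4 * Real.pi / Real.log (ρ / s) ^ 2 ≤ ∫ y in ann s ρ, ‖fderiv ℝ w y‖ ^ 3 := by
  have hL : 0 < Real.log (ρ / s) := Real.log_pos ((one_lt_div hs).2 hsρ)
  set L := Real.log (ρ / s) with hLdef
  have hfc : Continuous (fderiv ℝ w) := hw.continuous_fderiv (by simp)
  have hbc : ContinuousOn (fun y : E3 => (1 / (L * ‖y‖))) (ann s ρ) := by
    refine (ContinuousOn.div continuousOn_const (by fun_prop) ?_)
    intro y hy
    have : 0 < ‖y‖ := lt_of_lt_of_le hs hy.1
    positivity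
  have hmc : ContinuousOn (fun y : E3 => (1 / (L * ‖y‖)) ^ 2 * ‖fderiv ℝ w y‖) (ann s ρ) :=
    (hbc.pow 2).mul (by fun_prop)
  have hmid : 4 * Real.pi / L ^ 2 ≤ ∫ y in ann s ρ, (1 / (L * ‖y‖)) ^ 2 * ‖fderiv ℝ w y‖ := by
    obtain ⟨hi, he⟩ := polar_ann hs hsρ _ hmc
    rw [he]
    have : ∫ θ : sphere (0 : E3) 1, (1 / L ^ 2) ∂(volume : Measure E3).toSphere
        = 4 * Real.pi / L ^ 2 := by
      rw [integral_const, sphere_mass, smul_eq_mul]; ring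
    rw [← this]
    refine integral_mono (integrable_const _) hi fun θ => ?_
    have hθ : ‖(θ : E3)‖ = 1 := by simpa using θ.2
    have hcg : ∀ r ∈ uIcc s ρ, r ^ 2 * ((1 / (L * ‖r • (θ : E3)‖)) ^ 2 *
        ‖fderiv ℝ w (r • (θ : E3))‖) = (1 / L ^ 2) * ‖fderiv ℝ w (r • (θ : E3))‖ := by
      intro r hr
      rw [uIcc_of_le hsρ.le] at hr
      have hr0 : 0 < r := lt_of_lt_of_le hs hr.1
      rw [norm_smul r (θ : E3), hθ, Real.norm_of_nonneg hr0.le]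
      field_simp
    dsimp only
    rw [intervalIntegral.integral_congr hcg, intervalIntegral.integral_const_mul]
    exact le_mul_of_one_le_right (by positivity) (radial hs hsρ hw h0 h1 θ)
  have hb := integral_b hs hsρ
  rw [← hLdef] at hb
  have hi2 : IntegrableOn (fun y : E3 => (1 / (L * ‖y‖)) ^ 2 * ‖fderiv ℝ w y‖) (ann s ρ) :=
    hmc.integrableOn_compact (isCompact_ann s ρ)
  have hi3 : IntegrableOn (fun y : E3 => (1 / (L * ‖y‖)) ^ 3) (ann s ρ) :=
    (hbc.pow 3).integrableOn_compact (isCompact_ann s ρ)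
  have hi1 : IntegrableOn (fun y : E3 => ‖fderiv ℝ w y‖ ^ 3) (ann s ρ) :=
    ContinuousOn.integrableOn_compact (isCompact_ann s ρ) (by fun_prop)
  have key : ∫ y in ann s ρ, (3 * ((1 / (L * ‖y‖)) ^ 2 * ‖fderiv ℝ w y‖)
      - 2 * (1 / (L * ‖y‖)) ^ 3) ≤ ∫ y in ann s ρ, ‖fderiv ℝ w y‖ ^ 3 := by
    refine integral_mono ((hi2.const_mul 3).sub (hi3.const_mul 2)) hi1 fun y => ?_
    have ha : 0 ≤ ‖fderiv ℝ w y‖ := norm_nonneg _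
    have hb : 0 ≤ 1 / (L * ‖y‖) := by positivity
    dsimp only
    generalize ‖fderiv ℝ w y‖ = a at *
    generalize 1 / (L * ‖y‖) = b at *
    nlinarith [mul_nonneg (add_nonneg ha (add_nonneg hb hb)) (sq_nonneg (a - b))]
  rw [integral_sub (hi2.const_mul 3) (hi3.const_mul 2), integral_const_mul, integral_const_mul,
    hb] at key
  linarith

/-- Radial extremal profile as a function of `t = ‖y‖²`, cut off near zero. -/
noncomputable def prof (s ρ t : ℝ) : ℝ :=
  Real.smoothTransition (4 * t / s ^ 2 - 1) * (Real.log (t / s ^ 2) / (2 * Real.log (ρ / s)))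

lemma prof_smooth {s : ℝ} (ρ : ℝ) (hs : 0 < s) : ContDiff ℝ (⊤ : ℕ∞) (prof s ρ) := by
  rw [contDiff_iff_contDiffAt]
  intro t
  rcases lt_or_ge t (s ^ 2 / 4) with h | h
  · have : prof s ρ =ᶠ[nhds t] fun _ => 0 := by
      filter_upwards [Iio_mem_nhds h] with u hu
      have hu' : u < s ^ 2 / 4 := hu
      have : 4 * u / s ^ 2 - 1 ≤ 0 := by
        rw [sub_nonpos, div_le_one (by positivity)]; linarith
      simp [prof, Real.smoothTransition.zero_of_nonpos this]
    exact contDiffAt_const.congr_of_eventuallyEq this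
  · have ht : 0 < t := lt_of_lt_of_le (by positivity) h
    unfold prof
    refine ContDiffAt.mul ?_ (ContDiffAt.div_const (ContDiffAt.log ?_ ?_) _)
    · exact Real.smoothTransition.contDiffAt.comp t
        (((contDiffAt_const.mul contDiffAt_id).div_const _).sub contDiffAt_const)
    · exact contDiffAt_id.div_const _
    · positivity

lemma prof_eq {s : ℝ} (ρ : ℝ) (hs : 0 < s) {t : ℝ} (ht : s ^ 2 / 2 ≤ t) :
    prof s ρ t = Real.log (t / s ^ 2) / (2 * Real.log (ρ / s)) := by
  have : 1 ≤ 4 * t / s ^ 2 - 1 := by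
    rw [le_sub_iff_add_le, le_div_iff₀ (by positivity)]; linarith
  rw [prof, Real.smoothTransition.one_of_one_le this, one_mul]

lemma prof_deriv {s : ℝ} (ρ : ℝ) (hs : 0 < s) {t : ℝ} (ht : s ^ 2 ≤ t) :
    HasDerivAt (prof s ρ) (1 / (2 * Real.log (ρ / s) * t)) t := by
  have hs2 : 0 < s ^ 2 := by positivity
  have ht0 : 0 < t := by linarith
  have h1 : prof s ρ =ᶠ[nhds t] fun t => Real.log (t / s ^ 2) / (2 * Real.log (ρ / s)) := by
    filter_upwards [Ioi_mem_nhds (show s ^ 2 / 2 < t by linarith)] with u hu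
    exact prof_eq ρ hs (le_of_lt hu)
  refine HasDerivAt.congr_of_eventuallyEq ?_ h1
  have := (((hasDerivAt_id t).div_const (s ^ 2)).log (by simp; exact ⟨ht0.ne', hs.ne'⟩)).div_const
    (2 * Real.log (ρ / s))
  refine HasDerivAt.congr_deriv this ?_
  simp only [id]
  field_simp

lemma prof_fderiv {s ρ : ℝ} (hs : 0 < s) (hsρ : s < ρ) {y : E3} (hy : s ≤ ‖y‖) :
    ‖fderiv ℝ (fun y : E3 => prof s ρ (‖y‖ ^ 2)) y‖ = 1 / (Real.log (ρ / s) * ‖y‖) := by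
  have hL : 0 < Real.log (ρ / s) := Real.log_pos ((one_lt_div hs).2 hsρ)
  have hy0 : 0 < ‖y‖ := lt_of_lt_of_le hs hy
  have h := (prof_deriv ρ hs (pow_le_pow_left₀ hs.le hy 2)).comp_hasFDerivAt y
    (hasStrictFDerivAt_norm_sq y).hasFDerivAt
  have h' : HasFDerivAt (fun y : E3 => prof s ρ (‖y‖ ^ 2)) _ y := h
  rw [h'.fderiv, norm_smul, ← Nat.cast_smul_eq_nsmul ℝ, norm_smul, innerSL_apply_norm,
    Real.norm_of_nonneg (by positivity)]
  simp
  field_simp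

end Cap3

/-- The relative `3`-capacity of the spherical annulus in `ℝ³`: for
`0 < s < ρ`, the infimum over smooth `w : ℝ³ → ℝ` with `w = 0` on the sphere
of radius `s` and `w ≥ 1` outside the ball of radius `ρ` of
`∫_{s ≤ ‖y‖ ≤ ρ} ‖∇w‖³` equals `4π (log(ρ/s))⁻²`. -/
theorem stmt_12 (s ρ : ℝ) (hs : 0 < s) (hsρ : s < ρ) :
    sInf { c : ℝ | ∃ w : EuclideanSpace ℝ (Fin 3) → ℝ,
        ContDiff ℝ (⊤ : ℕ∞) w ∧
        (∀ y, ‖y‖ = s → w y = 0) ∧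
        (∀ y, ρ ≤ ‖y‖ → 1 ≤ w y) ∧
        c = ∫ y in {y : EuclideanSpace ℝ (Fin 3) | s ≤ ‖y‖ ∧ ‖y‖ ≤ ρ},
              ‖fderiv ℝ w y‖ ^ 3 } =
      4 * Real.pi / (Real.log (ρ / s)) ^ 2 := by
  have hL : 0 < Real.log (ρ / s) := Real.log_pos ((one_lt_div hs).2 hsρ)
  refine IsLeast.csInf_eq ⟨?_, ?_⟩
  · refine ⟨fun y => Cap3.prof s ρ (‖y‖ ^ 2),
      (Cap3.prof_smooth ρ hs).comp (contDiff_norm_sq ℝ), ?_, ?_, ?_⟩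
    · intro y hy
      have hs2 : 0 < s ^ 2 := by positivity
      dsimp only
      rw [hy, Cap3.prof_eq ρ hs (by linarith), div_self hs2.ne', Real.log_one, zero_div]
    · intro y hy
      have hs2 : 0 < s ^ 2 := by positivity
      have hle : s ^ 2 ≤ ‖y‖ ^ 2 := pow_le_pow_left₀ hs.le (hsρ.le.trans hy) 2
      dsimp only
      rw [Cap3.prof_eq ρ hs (by linarith), ← div_pow, Real.log_pow, le_div_iff₀ (by positivity)]
      have : Real.log (ρ / s) ≤ Real.log (‖y‖ / s) :=
        Real.log_le_log (div_pos (hs.trans hsρ) hs) (by gcongr)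
      push_cast
      linarith
    · rw [← Cap3.integral_b hs hsρ]
      refine MeasureTheory.setIntegral_congr_fun (Cap3.measurableSet_ann s ρ) fun y hy => ?_
      rw [Cap3.prof_fderiv hs hsρ hy.1]
  · rintro c ⟨w, hw, h0, h1, rfl⟩
    exact Cap3.lower hs hsρ hw h0 h1
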